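/- Suppose β > β₂ = e^{λ_max(A)}. Then there exists δ₀ > 0 such that for every δ ∈ (0,δ₀) there is a compact F_β-forward invariant set K (i.e. F_β(K) ⊆ K) with Θ×𝕋×[δ,1] ⊆ K ⊆ Θ×𝕋×(0,1], such that K(θ,α) = {r ∈ [0,∞) : (θ,α,r) ∈ K} is an interval for every (θ,α) ∈ Θ×𝕋. -/

import Mathlib

open Filter MeasureTheory Metric Set
open scoped Topology

noncomputable section

/-- ℝ² with the Euclidean norm. -/
abbrev R2 : Type := EuclideanSpace ℝ (Fin 2)

/-- Action of a 2×2 real matrix on Euclidean ℝ². -/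
def mulVecE (M : Matrix (Fin 2) (Fin 2) ℝ) (v : R2) : R2 :=
  (WithLp.equiv 2 (Fin 2 → ℝ)).symm (M.mulVec ((WithLp.equiv 2 (Fin 2 → ℝ)) v))

/-- Operator norm of a 2×2 real matrix induced by the Euclidean norm on ℝ². -/
def opNorm (M : Matrix (Fin 2) (Fin 2) ℝ) : ℝ :=
  ‖(Matrix.toEuclideanCLM (𝕜 := ℝ) M : R2 →L[ℝ] R2)‖

/-- The cocycle `A_n(θ) = A(γ^{n-1}θ) ⋯ A(θ)`. -/
def coc {Θ : Type*} (γ : Θ → Θ) (A : Θ → Matrix (Fin 2) (Fin 2) ℝ) :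
    ℕ → Θ → Matrix (Fin 2) (Fin 2) ℝ
  | 0, _ => 1
  | n + 1, θ => coc γ A n (γ θ) * A θ

/-- Maximal Lyapunov exponent `λ_max(A) = sup_θ limsup (1/n) log‖A_n(θ)‖`. -/
def lyapMax {Θ : Type*} (γ : Θ → Θ) (A : Θ → Matrix (Fin 2) (Fin 2) ℝ) : ℝ :=
  ⨆ θ : Θ, Filter.limsup (fun n : ℕ => Real.log (opNorm (coc γ A n θ)) / n) Filter.atTop

/-- The hypotheses on `h`: C² on [0,∞), strictly increasing, strictly concave, bounded,
nonnegative, `h 0 = 0`, `h' 0 = 1`. -/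
def GoodH (h : ℝ → ℝ) : Prop :=
  ContDiffOn ℝ 2 h (Set.Ici 0) ∧ StrictMonoOn h (Set.Ici 0) ∧
    StrictConcaveOn ℝ (Set.Ici 0) h ∧ BddAbove (h '' Set.Ici 0) ∧
    (∀ x ∈ Set.Ici (0 : ℝ), 0 ≤ h x) ∧ h 0 = 0 ∧ derivWithin h (Set.Ici 0) 0 = 1

/-- The scaling condition `sup_{x ≥ 0} h(x) ≤ (sup_θ ‖A(θ)‖)⁻¹`. -/
def Scaled {Θ : Type*} (A : Θ → Matrix (Fin 2) (Fin 2) ℝ) (h : ℝ → ℝ) : Prop :=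
  ∀ x ∈ Set.Ici (0 : ℝ), h x ≤ (⨆ θ : Θ, opNorm (A θ))⁻¹

open scoped Classical in
/-- The fibre maps `f_{β,θ}(v) = h(β‖v‖)·A(θ)·v/‖v‖`, `f_{β,θ}(0) = 0`. -/
def fibMap {Θ : Type*} (A : Θ → Matrix (Fin 2) (Fin 2) ℝ) (h : ℝ → ℝ) (β : ℝ)
    (θ : Θ) (v : R2) : R2 :=
  if v = 0 then 0 else (h (β * ‖v‖) / ‖v‖) • mulVecE (A θ) v

/-- The skew product `f_β(θ,v) = (γθ, f_{β,θ}(v))`. -/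
def skewProd {Θ : Type*} (γ : Θ → Θ) (A : Θ → Matrix (Fin 2) (Fin 2) ℝ) (h : ℝ → ℝ)
    (β : ℝ) : Θ × R2 → Θ × R2 :=
  fun p => (γ p.1, fibMap A h β p.1 p.2)

/-- The global attractor `𝒜_β = ⋂_{n∈ℕ} f_β^n(Θ × B̄₁(0))`. -/
def globalAttractor {Θ : Type*} (γ : Θ → Θ) (A : Θ → Matrix (Fin 2) (Fin 2) ℝ)
    (h : ℝ → ℝ) (β : ℝ) : Set (Θ × R2) :=
  ⋂ n : ℕ, (skewProd γ A h β)^[n] '' (Set.univ ×ˢ Metric.closedBall (0 : R2) 1)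

/-- The fibre `𝒜_β(θ) = {x : (θ,x) ∈ 𝒜_β}` of the global attractor. -/
def attractorFib {Θ : Type*} (γ : Θ → Θ) (A : Θ → Matrix (Fin 2) (Fin 2) ℝ)
    (h : ℝ → ℝ) (β : ℝ) (θ : Θ) : Set R2 :=
  {x : R2 | (θ, x) ∈ globalAttractor γ A h β}

/-- `v(α) = (cos 2πα, sin 2πα)ᵗ`. -/
def vFull (α : ℝ) : R2 :=
  (WithLp.equiv 2 (Fin 2 → ℝ)).symm ![Real.cos (2 * Real.pi * α), Real.sin (2 * Real.pi * α)]

/-- `(cos πα, sin πα)ᵗ`, representing the projective point `α ∈ 𝕋 ≅ ℝP¹`. -/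
def vHalf (α : ℝ) : R2 :=
  (WithLp.equiv 2 (Fin 2 → ℝ)).symm ![Real.cos (Real.pi * α), Real.sin (Real.pi * α)]

/-- The projective angle coordinate `p(w) = (1/π)·arg(w) mod 1 ∈ [0,1)` of a nonzero
vector `w ∈ ℝ²`; for `w ≠ 0` this equals `(1/π)·arctan(w₂/w₁) mod 1`. -/
def projAngle (w : R2) : ℝ :=
  Int.fract (Complex.arg (Complex.ofReal (w 0) + Complex.ofReal (w 1) * Complex.I) / Real.pi)

/-- The projective action `g(θ,α) = (γθ, g_θ(α))` of the cocycle on `Θ × 𝕋`,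
where `𝕋` is modelled by the fundamental domain `[0,1) ⊆ ℝ`. -/
def gMap {Θ : Type*} (γ : Θ → Θ) (A : Θ → Matrix (Fin 2) (Fin 2) ℝ) :
    Θ × ℝ → Θ × ℝ :=
  fun p => (γ p.1, projAngle (mulVecE (A p.1) (vHalf p.2)))

/-- `Ω(θ,α) = ‖A(θ)(cos πα, sin πα)ᵗ‖`. -/
def Omega {Θ : Type*} (A : Θ → Matrix (Fin 2) (Fin 2) ℝ) (p : Θ × ℝ) : ℝ :=
  ‖mulVecE (A p.1) (vHalf p.2)‖

/-- The fibre maps `F_{β,θ,α}(r) = h(βr)·Ω(θ,α)` of the double skew product. -/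
def dsFib {Θ : Type*} (A : Θ → Matrix (Fin 2) (Fin 2) ℝ) (h : ℝ → ℝ) (β : ℝ)
    (p : Θ × ℝ) (r : ℝ) : ℝ :=
  h (β * r) * Omega A p

/-- The double skew product `F_β(θ,α,r) = (g(θ,α), h(βr)·Ω(θ,α))` on `Θ × 𝕋 × [0,∞)`. -/
def dsMap {Θ : Type*} (γ : Θ → Θ) (A : Θ → Matrix (Fin 2) (Fin 2) ℝ) (h : ℝ → ℝ)
    (β : ℝ) : Θ × ℝ × ℝ → Θ × ℝ × ℝ :=
  fun p => ((gMap γ A (p.1, p.2.1)).1, (gMap γ A (p.1, p.2.1)).2, dsFib A h β (p.1, p.2.1) p.2.2)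

/-- `Ω_n(θ,α) = ∏_{i=0}^{n-1} Ω(g^i(θ,α))`. -/
def OmegaProd {Θ : Type*} (γ : Θ → Θ) (A : Θ → Matrix (Fin 2) (Fin 2) ℝ) (n : ℕ)
    (p : Θ × ℝ) : ℝ :=
  ∏ i ∈ Finset.range n, Omega A ((gMap γ A)^[i] p)

/-- `Γ(a,b) = inf_{a ≤ x ≤ 1} inf_{0 < q ≤ b} h(qx)/(q·h(x))`. -/
def GammaH (h : ℝ → ℝ) (a b : ℝ) : ℝ :=
  sInf {y : ℝ | ∃ x ∈ Set.Icc a 1, ∃ q ∈ Set.Ioc (0 : ℝ) b, y = h (q * x) / (q * h x)}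

/-- The inverse `g⁻¹(θ,α) = (γ⁻¹θ, projective angle of A(γ⁻¹θ)⁻¹·v(α))` of the
projective action. -/
def gInv {Θ : Type*} (γinv : Θ → Θ) (A : Θ → Matrix (Fin 2) (Fin 2) ℝ) :
    Θ × ℝ → Θ × ℝ :=
  fun p => (γinv p.1, projAngle (mulVecE (A (γinv p.1))⁻¹ (vHalf p.2)))

/-- `F^n_{β,g^{-n}(θ,α)}(1)`, the pullback iterate defining the upper bounding graph. -/
def pullback1 {Θ : Type*} (γ : Θ → Θ) (γinv : Θ → Θ) (A : Θ → Matrix (Fin 2) (Fin 2) ℝ)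
    (h : ℝ → ℝ) (β : ℝ) (n : ℕ) (p : Θ × ℝ) : ℝ :=
  ((dsMap γ A h β)^[n] (((gInv γinv A)^[n] p).1, ((gInv γinv A)^[n] p).2, 1)).2.2

lemma mulVecE_eq (M : Matrix (Fin 2) (Fin 2) ℝ) (v : R2) :
    mulVecE M v = (Matrix.toEuclideanCLM (𝕜 := ℝ) M : R2 →L[ℝ] R2) v := rfl

lemma mulVecE_mul (M N : Matrix (Fin 2) (Fin 2) ℝ) (v : R2) :
    mulVecE (M * N) v = mulVecE M (mulVecE N v) := by
  simp [mulVecE_eq, map_mul]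

lemma mulVecE_one (v : R2) : mulVecE 1 v = v := by
  simp [mulVecE_eq, map_one]

lemma mulVecE_smul (M : Matrix (Fin 2) (Fin 2) ℝ) (s : ℝ) (v : R2) :
    mulVecE M (s • v) = s • mulVecE M v := by
  simp [mulVecE_eq]

lemma norm_mulVecE_le (M : Matrix (Fin 2) (Fin 2) ℝ) (v : R2) :
    ‖mulVecE M v‖ ≤ opNorm M * ‖v‖ :=
  (Matrix.toEuclideanCLM (𝕜 := ℝ) M : R2 →L[ℝ] R2).le_opNorm v

lemma opNorm_nonneg (M : Matrix (Fin 2) (Fin 2) ℝ) : 0 ≤ opNorm M := norm_nonneg _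

lemma opNorm_mul_le (M N : Matrix (Fin 2) (Fin 2) ℝ) :
    opNorm (M * N) ≤ opNorm M * opNorm N := by
  simp only [opNorm, map_mul]
  exact norm_mul_le _ _

lemma opNorm_one : opNorm 1 = 1 := by
  simp [opNorm, map_one]

lemma continuous_toEuclideanCLM :
    Continuous fun M : Matrix (Fin 2) (Fin 2) ℝ =>
      (Matrix.toEuclideanCLM (𝕜 := ℝ) M : R2 →L[ℝ] R2) :=
  LinearMap.continuous_of_finiteDimensional
    ((Matrix.toEuclideanCLM (𝕜 := ℝ) (n := Fin 2)).toAlgEquiv.toLinearMap)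

lemma continuous_opNorm : Continuous opNorm := continuous_toEuclideanCLM.norm

lemma norm_le_opNorm_mul_norm_mulVecE {M : Matrix (Fin 2) (Fin 2) ℝ} (hM : M.det = 1)
    (v : R2) : ‖v‖ ≤ opNorm M * ‖mulVecE M v‖ := by
  rcases eq_or_ne v 0 with rfl | hv
  · simpa using mul_nonneg (opNorm_nonneg M) (norm_nonneg _)
  have hvpos : 0 < ‖v‖ := norm_pos_iff.mpr hv
  let w : R2 := (WithLp.equiv 2 (Fin 2 → ℝ)).symm ![-v 1, v 0]
  have hw : ‖w‖ = ‖v‖ := by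
    simp [EuclideanSpace.norm_eq, w, Fin.sum_univ_two, add_comm]
  have hsq (x : R2) : ‖x‖ ^ 2 = x 0 ^ 2 + x 1 ^ 2 := by
    simp [EuclideanSpace.norm_sq_eq, Fin.sum_univ_two]
  have hcross (x y : R2) : x 0 * y 1 - x 1 * y 0 ≤ ‖x‖ * ‖y‖ := by
    refine le_of_sq_le_sq ?_ (by positivity)
    rw [mul_pow, hsq, hsq]
    nlinarith [sq_nonneg (x 0 * y 0 + x 1 * y 1)]
  have hdet : mulVecE M v 0 * mulVecE M w 1 - mulVecE M v 1 * mulVecE M w 0 = ‖v‖ ^ 2 := by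
    rw [hsq]
    rw [Matrix.det_fin_two] at hM
    simp only [mulVecE, w, Matrix.mulVec, dotProduct, Fin.sum_univ_two, WithLp.equiv_apply,
      WithLp.equiv_symm_apply, Matrix.cons_val_zero, Matrix.cons_val_one]
    linear_combination (v 0 ^ 2 + v 1 ^ 2) * hM
  have h1 := hcross (mulVecE M v) (mulVecE M w)
  have h2 := norm_mulVecE_le M w
  rw [hw] at h2
  rw [hdet] at h1
  have h3 := mul_le_mul_of_nonneg_left h2 (norm_nonneg (mulVecE M v))
  refine le_of_mul_le_mul_right ?_ hvpos
  linarith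

lemma one_le_opNorm {M : Matrix (Fin 2) (Fin 2) ℝ} (hM : M.det = 1) : 1 ≤ opNorm M := by
  let v : R2 := EuclideanSpace.single 0 1
  have hv : ‖v‖ = 1 := by simp [v]
  have h1 := norm_le_opNorm_mul_norm_mulVecE hM v
  have h2 := norm_mulVecE_le M v
  rw [hv] at h1 h2
  nlinarith [opNorm_nonneg M]

section Cocycle

variable {Θ : Type*} (γ : Θ → Θ) (A : Θ → Matrix (Fin 2) (Fin 2) ℝ)

lemma coc_add (m k : ℕ) (θ : Θ) :
    coc γ A (m + k) θ = coc γ A m (γ^[k] θ) * coc γ A k θ := by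
  induction k generalizing θ with
  | zero => simp [coc]
  | succ k ih =>
    rw [← add_assoc]
    simp only [coc, Function.iterate_succ, Function.comp_apply, ih, mul_assoc]

variable {γ A}

lemma det_coc (hdet : ∀ θ, (A θ).det = 1) (n : ℕ) (θ : Θ) : (coc γ A n θ).det = 1 := by
  induction n generalizing θ with
  | zero => simp [coc]
  | succ n ih => simp [coc, Matrix.det_mul, ih, hdet]

lemma continuous_coc [TopologicalSpace Θ] (hγ : Continuous γ) (hA : Continuous A) (n : ℕ) :
    Continuous (coc γ A n) := by
  induction n with
  | zero => exact continuous_const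
  | succ n ih => exact (ih.comp hγ).matrix_mul hA

lemma opNorm_coc_le_pow {S : ℝ} (hS : ∀ θ, opNorm (A θ) ≤ S) (hS0 : 0 ≤ S) (n : ℕ) (θ : Θ) :
    opNorm (coc γ A n θ) ≤ S ^ n := by
  induction n generalizing θ with
  | zero => simp [coc, opNorm_one]
  | succ n ih =>
    rw [pow_succ]
    exact (opNorm_mul_le _ _).trans (mul_le_mul (ih _) (hS θ) (opNorm_nonneg _) (by positivity))

/-- If the limit superior growth rate is everywhere below `log c`, some positive iterate of the
cocycle at each point has norm below the corresponding power of `c`. -/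
lemma exists_opNorm_coc_lt_pow (hdet : ∀ θ, (A θ).det = 1) {S : ℝ}
    (hS : ∀ θ, opNorm (A θ) ≤ S) (hS1 : 1 ≤ S) {c : ℝ}
    (hc : Real.exp (lyapMax γ A) < c) (θ : Θ) :
    ∃ n, 0 < n ∧ opNorm (coc γ A n θ) < c ^ n := by
  have hc0 : 0 < c := (Real.exp_pos _).trans hc
  set u : Θ → ℕ → ℝ := fun θ n => Real.log (opNorm (coc γ A n θ)) / n with hu
  have hu0 (θ n) : 0 ≤ u θ n :=
    div_nonneg (Real.log_nonneg (one_le_opNorm (det_coc hdet n θ))) n.cast_nonneg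
  have huS (θ n) : u θ n ≤ Real.log S := by
    refine div_le_of_le_mul₀ n.cast_nonneg (Real.log_nonneg hS1) ?_
    rw [mul_comm, ← Real.log_pow]
    exact Real.log_le_log (zero_lt_one.trans_le (one_le_opNorm (det_coc hdet n θ)))
      (opNorm_coc_le_pow hS (by linarith) n θ)
  have hcob (θ) : IsCoboundedUnder (· ≤ ·) atTop (u θ) :=
    (isBoundedUnder_of ⟨0, hu0 θ⟩).isCoboundedUnder_le
  have hbdd (θ) : IsBoundedUnder (· ≤ ·) atTop (u θ) := isBoundedUnder_of ⟨_, huS θ⟩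
  have hsup : limsup (u θ) atTop ≤ lyapMax γ A := by
    refine le_ciSup (f := fun θ => limsup (u θ) atTop) ⟨Real.log S, ?_⟩ θ
    rintro _ ⟨θ', rfl⟩
    exact limsup_le_of_le (hcob θ') (Eventually.of_forall (huS θ'))
  have hlt : limsup (u θ) atTop < Real.log c :=
    hsup.trans_lt ((Real.lt_log_iff_exp_lt hc0).mpr hc)
  obtain ⟨n, hn, hn0⟩ :=
    ((eventually_lt_of_limsup_lt hlt (hbdd θ)).and (eventually_gt_atTop 0)).exists
  refine ⟨n, hn0, ?_⟩
  rw [hu, div_lt_iff₀ (by exact_mod_cast hn0), mul_comm, ← Real.log_pow] at hn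
  exact (Real.log_lt_log_iff (zero_lt_one.trans_le (one_le_opNorm (det_coc hdet n θ)))
    (by positivity)).mp hn

/-- Uniform growth bound for the cocycle, obtained from the pointwise one by compactness and
by cutting orbits into pieces of bounded length. -/
lemma exists_opNorm_coc_le [TopologicalSpace Θ] [CompactSpace Θ] (hγ : Continuous γ)
    (hA : Continuous A) (hdet : ∀ θ, (A θ).det = 1) {S : ℝ} (hS : ∀ θ, opNorm (A θ) ≤ S)
    (hS1 : 1 ≤ S) {c : ℝ} (hcS : c ≤ S) (hc : Real.exp (lyapMax γ A) < c) :
    ∃ C, ∀ n θ, opNorm (coc γ A n θ) ≤ C * c ^ n := by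
  have hc0 : 0 < c := (Real.exp_pos _).trans hc
  choose k hk0 hk using exists_opNorm_coc_lt_pow hdet hS hS1 hc
  have hopen (θ : Θ) : IsOpen {x | opNorm (coc γ A (k θ) x) < c ^ k θ} :=
    isOpen_lt (continuous_opNorm.comp (continuous_coc hγ hA _)) continuous_const
  obtain ⟨t, ht⟩ := isCompact_univ.elim_finite_subcover _ hopen
    fun θ _ => mem_iUnion.mpr ⟨θ, hk θ⟩
  set M := t.sup k
  have hM (θ : Θ) : ∃ n, 0 < n ∧ n ≤ M ∧ opNorm (coc γ A n θ) < c ^ n := by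
    obtain ⟨θ', hθ', h⟩ := mem_iUnion₂.mp (ht (mem_univ θ))
    exact ⟨k θ', hk0 θ', Finset.le_sup hθ', h⟩
  refine ⟨(S / c) ^ M, fun n => ?_⟩
  induction n using Nat.strong_induction_on with
  | _ n ih =>
    intro θ
    rcases lt_or_ge n M with hn | hn
    · calc opNorm (coc γ A n θ) ≤ S ^ n := opNorm_coc_le_pow hS (by linarith) n θ
        _ = (S / c) ^ n * c ^ n := by rw [← mul_pow, div_mul_cancel₀ _ hc0.ne']
        _ ≤ (S / c) ^ M * c ^ n := by
          gcongr
          exact (one_le_div hc0).mpr hcS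
    · obtain ⟨m, hm0, hmM, hm⟩ := hM θ
      obtain ⟨l, rfl⟩ := Nat.exists_eq_add_of_le' (hmM.trans hn)
      rw [coc_add, pow_add, ← mul_assoc]
      exact (opNorm_mul_le _ _).trans
        (mul_le_mul (ih l (by omega) _) hm.le (opNorm_nonneg _) (by positivity))

/-- Uniform growth bound with the constant absorbed into a larger rate. -/
lemma exists_opNorm_coc_le_pow [TopologicalSpace Θ] [CompactSpace Θ] (hγ : Continuous γ)
    (hA : Continuous A) (hdet : ∀ θ, (A θ).det = 1) {S : ℝ} (hS : ∀ θ, opNorm (A θ) ≤ S)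
    (hS1 : 1 ≤ S) {c : ℝ} (hcS : c ≤ S) (hc : Real.exp (lyapMax γ A) < c) :
    ∃ n, 0 < n ∧ ∀ θ, opNorm (coc γ A n θ) ≤ c ^ n := by
  obtain ⟨b, hb, hbc⟩ := exists_between hc
  have hb0 : 0 < b := (Real.exp_pos _).trans hb
  obtain ⟨C, hC⟩ := exists_opNorm_coc_le hγ hA hdet hS hS1 (hbc.le.trans hcS) hb
  obtain ⟨n, hn, hn0⟩ := (((tendsto_pow_atTop_atTop_of_one_lt
    ((one_lt_div hb0).mpr hbc)).eventually_ge_atTop C).and (eventually_gt_atTop 0)).exists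
  refine ⟨n, hn0, fun θ => (hC n θ).trans ?_⟩
  rw [div_pow, le_div_iff₀ (by positivity)] at hn
  exact hn

end Cocycle

lemma norm_vHalf (α : ℝ) : ‖vHalf α‖ = 1 := by
  simp [EuclideanSpace.norm_eq, vHalf, Fin.sum_univ_two]

lemma continuous_vHalf : Continuous vHalf := by
  refine (PiLp.continuous_toLp 2 _).comp (continuous_pi fun i => ?_)
  fin_cases i <;> simp <;> fun_prop

lemma vHalf_one : vHalf 1 = (-1 : ℝ) • vHalf 0 := by
  ext i
  fin_cases i <;> simp [vHalf]

lemma exists_vHalf_projAngle {w : R2} (hw : w ≠ 0) :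
    ∃ s : ℝ, |s| * ‖w‖ = 1 ∧ vHalf (projAngle w) = s • w := by
  set z : ℂ := Complex.ofReal (w 0) + Complex.ofReal (w 1) * Complex.I with hz
  have hre : z.re = w 0 := by simp [hz]
  have him : z.im = w 1 := by simp [hz]
  have hzw : ‖z‖ = ‖w‖ := by
    rw [EuclideanSpace.norm_eq, Complex.norm_eq_sqrt_sq_add_sq, hre, him]
    simp [Fin.sum_univ_two]
  have hwn : ‖w‖ ≠ 0 := norm_ne_zero_iff.mpr hw
  have hz0 : z ≠ 0 := norm_ne_zero_iff.mp (hzw ▸ hwn)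
  set k := ⌊z.arg / Real.pi⌋ with hk
  have hp : Real.pi * projAngle w = z.arg - k * Real.pi := by
    simp only [projAngle, Int.fract, ← hz, ← hk]
    field_simp
  refine ⟨(-1) ^ k * ‖w‖⁻¹, ?_, ?_⟩
  · simp [abs_mul, hwn]
  · ext i
    fin_cases i
    · simp only [vHalf, hp, Real.cos_sub_int_mul_pi, Complex.cos_arg hz0, hre, hzw]
      simp; ring
    · simp only [vHalf, hp, Real.sin_sub_int_mul_pi, Complex.sin_arg, him, hzw]
      simp; ring

lemma projAngle_mem_Ico (w : R2) : projAngle w ∈ Ico (0 : ℝ) 1 :=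
  ⟨Int.fract_nonneg _, Int.fract_lt_one _⟩

/-- The truncated infimum `min_{n ≤ N} cⁿ ‖A_n(θ) v‖`, which decreases at rate at most `c⁻¹`
along the cocycle when `N` is large. -/
def adaptedGauge {Θ : Type*} (γ : Θ → Θ) (A : Θ → Matrix (Fin 2) (Fin 2) ℝ) (c : ℝ) (N : ℕ)
    (p : Θ × R2) : ℝ :=
  (Finset.range (N + 1)).inf' Finset.nonempty_range_add_one
    fun n => c ^ n * ‖mulVecE (coc γ A n p.1) p.2‖

section Gauge

variable {Θ : Type*} {γ : Θ → Θ} {A : Θ → Matrix (Fin 2) (Fin 2) ℝ} {c : ℝ} {N : ℕ}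

lemma continuous_adaptedGauge [TopologicalSpace Θ] (hγ : Continuous γ) (hA : Continuous A) :
    Continuous (adaptedGauge γ A c N) := by
  refine Continuous.finset_inf'_apply _ fun n _ => continuous_const.mul (Continuous.norm ?_)
  exact (continuous_toEuclideanCLM.comp
    ((continuous_coc hγ hA n).comp continuous_fst)).clm_apply continuous_snd

lemma adaptedGauge_smul (s : ℝ) (θ : Θ) (v : R2) :
    adaptedGauge γ A c N (θ, s • v) = |s| * adaptedGauge γ A c N (θ, v) := by
  have hmono : Monotone fun x : ℝ => |s| * x := fun _ _ h =>
    mul_le_mul_of_nonneg_left h (abs_nonneg s)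
  simp only [adaptedGauge, mulVecE_smul, norm_smul, Real.norm_eq_abs, mul_left_comm _ |s|]
  exact (Finset.apply_inf'_eq_inf'_comp _ (fun x : ℝ => |s| * x) (fun x y => hmono.map_min)).symm

lemma adaptedGauge_le_mul (hN : ∀ θ v, ‖v‖ ≤ c ^ (N + 1) * ‖mulVecE (coc γ A (N + 1) θ) v‖)
    (hc : 0 < c) (θ : Θ) (v : R2) :
    adaptedGauge γ A c N (θ, v) ≤ c * adaptedGauge γ A c N (γ θ, mulVecE (A θ) v) := by
  rw [← div_le_iff₀' hc]
  refine Finset.le_inf' _ _ fun n hn => ?_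
  rw [div_le_iff₀' hc, ← mul_assoc, ← pow_succ', ← mulVecE_mul]
  change _ ≤ c ^ (n + 1) * ‖mulVecE (coc γ A (n + 1) θ) v‖
  rcases (Nat.lt_succ_iff.mp (Finset.mem_range.mp hn)).lt_or_eq with h | rfl
  · exact Finset.inf'_le _ (Finset.mem_range.mpr (Nat.succ_lt_succ h))
  · refine le_trans (Finset.inf'_le _ (Finset.mem_range.mpr (Nat.succ_pos n))) ?_
    simpa [coc, mulVecE_one] using hN θ v

lemma pow_mul_norm_le_adaptedGauge (hdet : ∀ θ, (A θ).det = 1) {S : ℝ}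
    (hS : ∀ θ, opNorm (A θ) ≤ S) (hc : 0 < c) (hcS : c ≤ S) (θ : Θ) (v : R2) :
    (c / S) ^ N * ‖v‖ ≤ adaptedGauge γ A c N (θ, v) := by
  have hS0 : 0 < S := hc.trans_le hcS
  refine Finset.le_inf' _ _ fun n hn => ?_
  have h1 : (c / S) ^ N ≤ (c / S) ^ n :=
    pow_le_pow_of_le_one (by positivity) ((div_le_one hS0).mpr hcS)
      (Nat.lt_succ_iff.mp (Finset.mem_range.mp hn))
  have h2 : ‖v‖ ≤ S ^ n * ‖mulVecE (coc γ A n θ) v‖ :=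
    (norm_le_opNorm_mul_norm_mulVecE (det_coc hdet n θ) v).trans
      (mul_le_mul_of_nonneg_right (opNorm_coc_le_pow hS hS0.le n θ) (norm_nonneg _))
  calc (c / S) ^ N * ‖v‖ ≤ (c / S) ^ n * (S ^ n * ‖mulVecE (coc γ A n θ) v‖) := by gcongr
    _ = c ^ n * ‖mulVecE (coc γ A n θ) v‖ := by
      rw [← mul_assoc, ← mul_pow, div_mul_cancel₀ _ hS0.ne']

end Gauge

lemma GoodH.exists_mul_le {h : ℝ → ℝ} (hh : GoodH h) {β c : ℝ} (hβ : 0 < β) (hcβ : c < β) :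
    ∃ δ₀, 0 < δ₀ ∧ ∀ r ∈ Ioo 0 δ₀, c * r ≤ h (β * r) := by
  obtain ⟨hC, -, -, -, -, h0, h1⟩ := hh
  have hd : HasDerivWithinAt h 1 (Ici 0) 0 :=
    h1 ▸ ((hC.differentiableOn (by norm_num)) 0 self_mem_Ici).hasDerivWithinAt
  have hslope := hasDerivWithinAt_iff_tendsto_slope.mp hd
  rw [Ici_sdiff_left] at hslope
  have hev := hslope.eventually_const_lt ((div_lt_one hβ).mpr hcβ)
  obtain ⟨ε, hε, hsub⟩ := mem_nhdsGT_iff_exists_Ioo_subset.mp hev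
  refine ⟨ε / β, div_pos hε hβ, fun r hr => ?_⟩
  have hr' : 0 < β * r := mul_pos hβ hr.1
  have hlt := hsub ⟨hr', (lt_div_iff₀' hβ).mp hr.2⟩
  simp only [mem_ofPred_eq, slope_def_field, h0, sub_zero] at hlt
  rw [div_lt_div_iff₀ hβ hr'] at hlt
  nlinarith

lemma GoodH.min_mul_le {h : ℝ → ℝ} (hh : GoodH h) {β c δ₀ δ : ℝ} (hβ : 0 < β)
    (hδ₀ : ∀ r ∈ Ioo 0 δ₀, c * r ≤ h (β * r)) (hδ : δ ∈ Ioo 0 δ₀) {r : ℝ} (hr : 0 < r) :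
    c * min r δ ≤ h (β * r) := by
  have hm : min r δ ∈ Ioo 0 δ₀ := ⟨lt_min hr hδ.1, (min_le_right _ _).trans_lt hδ.2⟩
  refine (hδ₀ _ hm).trans (hh.2.1.monotoneOn (mul_pos hβ hm.1).le (mul_pos hβ hr).le ?_)
  gcongr
  exact min_le_left _ _

/-- If `β > β₂ = e^{λ_max(A)}`, there is `δ₀ > 0` such that for every
`δ ∈ (0,δ₀)` there is a compact forward invariant set `K` with
`Θ×𝕋×[δ,1] ⊆ K ⊆ Θ×𝕋×(0,1]` whose fibres `K(θ,α)` are intervals. Here `𝕋` is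
modelled by `[0,1) ⊆ ℝ` and compactness is stated for the image of `K` in
`Θ × (ℝ/ℤ) × ℝ`. -/
theorem stmt14 {Θ : Type*} [MetricSpace Θ] [CompactSpace Θ]
    (γ : Θ ≃ₜ Θ)
    (A : Θ → Matrix (Fin 2) (Fin 2) ℝ) (hdet : ∀ θ, (A θ).det = 1) (hA : Continuous A)
    (h : ℝ → ℝ) (hh : GoodH h) (hscale : Scaled A h)
    (β : ℝ) (hβ : Real.exp (lyapMax ⇑γ A) < β) :
    ∃ δ₀ : ℝ, 0 < δ₀ ∧ ∀ δ ∈ Set.Ioo (0 : ℝ) δ₀,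
      ∃ K : Set (Θ × ℝ × ℝ),
        IsCompact
          ((fun p : Θ × ℝ × ℝ => (p.1, ((p.2.1 : ℝ) : AddCircle (1 : ℝ)), p.2.2)) '' K) ∧
        Set.MapsTo (dsMap ⇑γ A h β) K K ∧
        Set.univ ×ˢ (Set.Ico (0 : ℝ) 1 ×ˢ Set.Icc δ 1) ⊆ K ∧
        K ⊆ Set.univ ×ˢ (Set.Ico (0 : ℝ) 1 ×ˢ Set.Ioc (0 : ℝ) 1) ∧
        ∀ θ : Θ, ∀ α : ℝ, Set.OrdConnected {r : ℝ | (θ, α, r) ∈ K} := by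
  have hβ0 : 0 < β := (Real.exp_pos _).trans hβ
  obtain ⟨c, hc, hcβ⟩ := exists_between hβ
  have hc0 : 0 < c := (Real.exp_pos _).trans hc
  have hbdd : BddAbove (range fun θ => opNorm (A θ)) :=
    (isCompact_range (continuous_opNorm.comp hA)).bddAbove
  obtain ⟨S, hS, hS1, hcS⟩ : ∃ S, (∀ θ, opNorm (A θ) ≤ S) ∧ 1 ≤ S ∧ c ≤ S := by
    obtain ⟨B, hB⟩ := hbdd
    exact ⟨max B (max 1 c), fun θ => (hB ⟨θ, rfl⟩).trans (le_max_left _ _), by simp, by simp⟩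
  obtain ⟨n, hn0, hn⟩ := exists_opNorm_coc_le_pow γ.continuous hA hdet hS hS1 hcS hc
  obtain ⟨N, rfl⟩ := Nat.exists_eq_succ_of_ne_zero hn0.ne'
  have hN (θ v) : ‖v‖ ≤ c ^ (N + 1) * ‖mulVecE (coc γ A (N + 1) θ) v‖ :=
    (norm_le_opNorm_mul_norm_mulVecE (det_coc hdet _ θ) v).trans
      (mul_le_mul_of_nonneg_right (hn θ) (norm_nonneg _))
  set G : Θ × ℝ → ℝ := fun p => adaptedGauge γ A c N (p.1, vHalf p.2) with hG
  have hGcont : Continuous G := (continuous_adaptedGauge γ.continuous hA).comp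
    (continuous_fst.prodMk (continuous_vHalf.comp continuous_snd))
  set m := (c / S) ^ N
  have hm0 : 0 < m := by positivity
  have hGm (p) : m ≤ G p := by
    simpa [norm_vHalf] using
      pow_mul_norm_le_adaptedGauge (γ := γ) (N := N) hdet hS hc0 hcS p.1 (vHalf p.2)
  have hGper (θ) : G (θ, 1) = G (θ, 0) := by
    simp only [hG, vHalf_one, adaptedGauge_smul, abs_neg, abs_one, one_mul]
  have hpos {δ r p} (hδ : 0 < δ) (hr : δ * m ≤ r * G p) : 0 < r :=
    (pos_iff_pos_of_mul_pos ((mul_pos hδ hm0).trans_le hr)).mpr (hm0.trans_le (hGm p))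
  obtain ⟨δ₀, hδ₀, hlow⟩ := hh.exists_mul_le hβ0 hcβ
  refine ⟨δ₀, hδ₀, fun δ hδ => ⟨{p | p.2.1 ∈ Ico (0 : ℝ) 1 ∧ p.2.2 ∈ Icc (0 : ℝ) 1 ∧
    δ * m ≤ p.2.2 * G (p.1, p.2.1)}, ?_, ?_, ?_, ?_, ?_⟩⟩
  · have hK : IsCompact {p : Θ × ℝ × ℝ | p ∈ univ ×ˢ (Icc (0 : ℝ) 1 ×ˢ Icc (0 : ℝ) 1) ∧
        δ * m ≤ p.2.2 * G (p.1, p.2.1)} :=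
      (isCompact_univ.prod (isCompact_Icc.prod isCompact_Icc)).inter_right
        (isClosed_le continuous_const ((continuous_snd.comp continuous_snd).mul
          (hGcont.comp (continuous_fst.prodMk (continuous_fst.comp continuous_snd)))))
    convert hK.image (f := fun p : Θ × ℝ × ℝ =>
      (p.1, ((p.2.1 : ℝ) : AddCircle (1 : ℝ)), p.2.2)) ?_ using 1
    · refine Subset.antisymm (image_mono fun p hp => ⟨⟨trivial, Ico_subset_Icc_self hp.1, hp.2.1⟩,
        hp.2.2⟩) ?_
      rintro _ ⟨⟨θ, α, r⟩, ⟨⟨-, hα, hr⟩, hGr⟩, rfl⟩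
      rcases hα.2.lt_or_eq with hlt | heq
      · exact ⟨(θ, α, r), ⟨⟨hα.1, hlt⟩, hr, hGr⟩, rfl⟩
      · dsimp only at heq
        subst heq
        refine ⟨(θ, 0, r), ⟨by simp, hr, by simpa [hGper] using hGr⟩, ?_⟩
        simpa using (AddCircle.coe_period (1 : ℝ)).symm
    · exact continuous_fst.prodMk (((AddCircle.continuous_mk' (1 : ℝ)).comp
        (continuous_fst.comp continuous_snd)).prodMk (continuous_snd.comp continuous_snd))
  · rintro ⟨θ, α, r⟩ ⟨hα, hr, hGr⟩
    have hr0 : 0 < r := hpos hδ.1 hGr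
    have hhr : 0 ≤ h (β * r) := hh.2.2.2.2.1 _ (mul_pos hβ0 hr0).le
    set w := mulVecE (A θ) (vHalf α) with hw
    have hw0 : w ≠ 0 := fun h0 => by
      have := norm_le_opNorm_mul_norm_mulVecE (hdet θ) (vHalf α)
      rw [norm_vHalf, ← hw, h0, norm_zero, mul_zero] at this
      linarith
    obtain ⟨s, hs, hsw⟩ := exists_vHalf_projAngle hw0
    refine ⟨projAngle_mem_Ico _, ⟨mul_nonneg hhr (norm_nonneg _), ?_⟩, ?_⟩
    · calc h (β * r) * ‖w‖ ≤ (⨆ θ, opNorm (A θ))⁻¹ * ⨆ θ, opNorm (A θ) := by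
            have h1 : ‖w‖ ≤ opNorm (A θ) := by
              simpa [norm_vHalf] using norm_mulVecE_le (A θ) (vHalf α)
            exact mul_le_mul (hscale _ (mul_pos hβ0 hr0).le) (h1.trans (le_ciSup hbdd θ))
              (norm_nonneg _) (inv_nonneg.mpr (Real.iSup_nonneg fun θ => opNorm_nonneg _))
        _ ≤ 1 := inv_mul_le_one
    · change δ * m ≤ h (β * r) * ‖w‖ * adaptedGauge γ A c N (γ θ, vHalf (projAngle w))
      rw [hsw, adaptedGauge_smul]
      have hg : G (θ, α) ≤ c * adaptedGauge γ A c N (γ θ, w) :=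
        adaptedGauge_le_mul hN hc0 θ (vHalf α)
      have hmin : δ * m ≤ min r δ * G (θ, α) := by
        rcases min_choice r δ with h | h <;> rw [h]
        · exact hGr
        · exact mul_le_mul_of_nonneg_left (hGm _) hδ.1.le
      have hmin0 : 0 < min r δ := lt_min hr0 hδ.1
      have hg0 : 0 ≤ adaptedGauge γ A c N (γ θ, w) :=
        nonneg_of_mul_nonneg_right ((hm0.le.trans (hGm _)).trans hg) hc0
      calc δ * m ≤ min r δ * G (θ, α) := hmin
        _ ≤ min r δ * (c * adaptedGauge γ A c N (γ θ, w)) := by gcongr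
        _ = c * min r δ * adaptedGauge γ A c N (γ θ, w) := by ring
        _ ≤ h (β * r) * adaptedGauge γ A c N (γ θ, w) := by
          gcongr
          exact hh.min_mul_le hβ0 hlow hδ hr0
        _ = h (β * r) * ‖w‖ * (|s| * adaptedGauge γ A c N (γ θ, w)) := by
          linear_combination (-h (β * r) * adaptedGauge γ A c N (γ θ, w)) * hs
  · rintro ⟨θ, α, r⟩ ⟨-, hα, hr⟩
    exact ⟨hα, ⟨hδ.1.le.trans hr.1, hr.2⟩,
      mul_le_mul hr.1 (hGm _) hm0.le (hδ.1.le.trans hr.1)⟩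
  · rintro ⟨θ, α, r⟩ ⟨hα, hr, hGr⟩
    exact ⟨trivial, hα, hpos hδ.1 hGr, hr.2⟩
  · intro θ α
    refine ⟨fun x hx y hy r hr => ⟨hx.1, ⟨hx.2.1.1.trans hr.1, hr.2.trans hy.2.1.2⟩,
      hx.2.2.trans (mul_le_mul_of_nonneg_right hr.1 (hm0.le.trans (hGm _)))⟩⟩
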